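/- Let (P_t)_{t≥0} be a Markov–Feller semigroup on a Polish space X that is Cesàro eventually continuous on X. Then any two distinct ergodic invariant probability measures μ and ν of (P_t) have disjoint supports: supp μ ∩ supp ν = ∅. -/

import Mathlib

open MeasureTheory Filter Metric Set Topology
open scoped ENNReal

/-- A Markov–Feller semigroup on a metric measurable space `X`: a family of Markov
kernels `P t` (for `t ≥ 0`) such that `P 0` is the identity kernel, the
Chapman–Kolmogorov semigroup property holds, `x ↦ ∫ f d(P t x)` is continuous for
every bounded continuous `f` (Feller property), and `t ↦ ∫ f d(P t x)` is Borel
measurable. -/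
structure MarkovFellerSemigroup (X : Type*) [MetricSpace X] [MeasurableSpace X]
    [BorelSpace X] where
  P : ℝ → X → Measure X
  isProb : ∀ t, 0 ≤ t → ∀ x, IsProbabilityMeasure (P t x)
  measurable_x : ∀ t, 0 ≤ t → Measurable (P t)
  id0 : ∀ x, P 0 x = Measure.dirac x
  semigroup : ∀ s t : ℝ, 0 ≤ s → 0 ≤ t → ∀ x, P (t + s) x = (P t x).bind (P s)
  feller : ∀ (f : BoundedContinuousFunction X ℝ) (t : ℝ), 0 ≤ t →
    Continuous fun x => ∫ y, f y ∂ P t x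
  measurable_t : ∀ (f : BoundedContinuousFunction X ℝ) (x : X),
    Measurable fun t : ℝ => ∫ y, f y ∂ P t x

namespace MarkovFellerSemigroup

variable {X : Type*} [MetricSpace X] [MeasurableSpace X] [BorelSpace X]

/-- `P_t f (x) = ∫ f(y) P_t(x, dy)`. -/
noncomputable def Pf (S : MarkovFellerSemigroup X) (t : ℝ) (f : X → ℝ) (x : X) : ℝ :=
  ∫ y, f y ∂ S.P t x

/-- The Cesàro average `Q_t f (x) = (1/t) ∫_0^t P_s f (x) ds`. -/
noncomputable def Qf (S : MarkovFellerSemigroup X) (t : ℝ) (f : X → ℝ) (x : X) : ℝ :=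
  (1 / t) * ∫ s in (0:ℝ)..t, S.Pf s f x

/-- The Cesàro average `Q_t(x, A) = (1/t) ∫_0^t P_s(x, A) ds`. -/
noncomputable def Qmeas (S : MarkovFellerSemigroup X) (t : ℝ) (x : X) (A : Set X) : ℝ :=
  (1 / t) * ∫ s in (0:ℝ)..t, (S.P s x A).toReal

/-- The action `P_t μ = ∫ P_t(x, ·) μ(dx)` of the semigroup on measures. -/
noncomputable def Pmeas (S : MarkovFellerSemigroup X) (t : ℝ) (μ : Measure X) : Measure X :=
  μ.bind (S.P t)

/-- `⟨f, Q_t μ⟩ = (1/t) ∫_0^t ⟨f, P_s μ⟩ ds`. -/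
noncomputable def QfM (S : MarkovFellerSemigroup X) (t : ℝ) (f : X → ℝ) (μ : Measure X) : ℝ :=
  (1 / t) * ∫ s in (0:ℝ)..t, ∫ x, S.Pf s f x ∂μ

/-- The set `T` of points `x` for which the family `{Q_t(x,·)}_{t>0}` is tight. -/
def Tset (S : MarkovFellerSemigroup X) : Set X :=
  {x | ∀ ε > (0:ℝ), ∃ K : Set X, IsCompact K ∧ ∀ t > (0:ℝ), 1 - ε ≤ S.Qmeas t x K}

/-- Bounded Lipschitz real-valued functions, the class `L_b(X)`. -/
def IsBddLipschitz (f : X → ℝ) : Prop :=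
  (∃ K, LipschitzWith K f) ∧ ∃ M, ∀ x, |f x| ≤ M

/-- Eventual continuity at `z`: for every bounded Lipschitz `f`,
`limsup_{x → z} limsup_{t → ∞} |P_t f(x) − P_t f(z)| = 0`. -/
def EvContAt (S : MarkovFellerSemigroup X) (z : X) : Prop :=
  ∀ f : X → ℝ, IsBddLipschitz f →
    limsup (fun x => limsup (fun t => |S.Pf t f x - S.Pf t f z|) atTop) (𝓝 z) = 0

/-- Cesàro eventual continuity at `z`: for every bounded Lipschitz `f`,
`limsup_{x → z} limsup_{t → ∞} |Q_t f(x) − Q_t f(z)| = 0`. -/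
def CesaroEvContAt (S : MarkovFellerSemigroup X) (z : X) : Prop :=
  ∀ f : X → ℝ, IsBddLipschitz f →
    limsup (fun x => limsup (fun t => |S.Qf t f x - S.Qf t f z|) atTop) (𝓝 z) = 0

/-- An invariant probability measure of the semigroup. -/
def Invariant (S : MarkovFellerSemigroup X) (μ : Measure X) : Prop :=
  IsProbabilityMeasure μ ∧ ∀ t, 0 ≤ t → S.Pmeas t μ = μ

/-- An ergodic invariant probability measure: an invariant probability measure `μ`
such that whenever `μ = (1/2)(μ₁ + μ₂)` with `μ₁, μ₂` invariant probability
measures, `μ₁ = μ₂ = μ`. -/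
def ErgodicInv (S : MarkovFellerSemigroup X) (μ : Measure X) : Prop :=
  S.Invariant μ ∧ ∀ μ₁ μ₂ : Measure X, S.Invariant μ₁ → S.Invariant μ₂ →
    μ = (2 : ℝ≥0∞)⁻¹ • (μ₁ + μ₂) → μ₁ = μ ∧ μ₂ = μ

/-- The support of a measure: points all of whose balls have positive measure. -/
def msupp (μ : Measure X) : Set X :=
  {x | ∀ ε > (0:ℝ), 0 < μ (ball x ε)}

/-- `Q_t(x,·)` converges weakly to `μ` as `t → ∞`. -/
def QWeakLim (S : MarkovFellerSemigroup X) (x : X) (μ : Measure X) : Prop :=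
  ∀ f : BoundedContinuousFunction X ℝ,
    Tendsto (fun t => S.Qf t f x) atTop (𝓝 (∫ y, f y ∂μ))

/-- `Q_t ν` converges weakly to `μ` as `t → ∞`. -/
def QWeakLimM (S : MarkovFellerSemigroup X) (ν : Measure X) (μ : Measure X) : Prop :=
  ∀ f : BoundedContinuousFunction X ℝ,
    Tendsto (fun t => S.QfM t f ν) atTop (𝓝 (∫ y, f y ∂μ))

end MarkovFellerSemigroup

theorem aux_exists_limit {X : Type*} [MeasurableSpace X] (U : Ultrafilter ℕ)
    (m : ℕ → Measure X) (hp : ∀ n, IsProbabilityMeasure (m n)) (μ : Measure X)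
    [IsProbabilityMeasure μ] (c : ℝ≥0∞) (hc : c ≠ ⊤)
    (hm : ∀ n A, MeasurableSet A → m n A ≤ c * μ A) :
    ∃ l : Measure X, IsProbabilityMeasure l ∧ (∀ A, MeasurableSet A → l A ≤ c * μ A) ∧
      ∀ A, MeasurableSet A → Tendsto (fun n => m n A) U (𝓝 (l A)) := by
  have hex : ∀ A : Set X, ∃ a : ℝ≥0∞, Tendsto (fun n => m n A) U (𝓝 a) := by
    intro A
    exact ⟨_, (U.map (fun n => m n A)).le_nhds_lim⟩
  choose L hL using hex
  have hadd : ∀ A B, MeasurableSet B → Disjoint A B → L (A ∪ B) = L A + L B := by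
    intro A B hB hAB
    refine tendsto_nhds_unique (hL _) ?_
    refine ((hL A).add (hL B)).congr fun n => ?_
    rw [measure_union hAB hB]
  have hle : ∀ A, MeasurableSet A → L A ≤ c * μ A := fun A hA =>
    le_of_tendsto (hL A) (Eventually.of_forall fun n => hm n A hA)
  have hmono : ∀ A B, A ⊆ B → L A ≤ L B := fun A B hAB =>
    le_of_tendsto_of_tendsto (hL A) (hL B) (Eventually.of_forall fun n => measure_mono hAB)
  have h0 : L ∅ = 0 := by
    refine tendsto_nhds_unique (hL _) ?_
    simp
  have h1 : L univ = 1 := by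
    refine tendsto_nhds_unique (hL _) ?_
    simp
  have hU : ∀ ⦃f : ℕ → Set X⦄ (_ : ∀ i, MeasurableSet (f i)),
        Pairwise (Function.onFun Disjoint f) → L (⋃ i, f i) = ∑' i, L (f i) := by
    intro f hf hd
    have hacc : ∀ n, L (⋃ i ∈ Finset.range n, f i) = ∑ i ∈ Finset.range n, L (f i) := by
      intro n
      refine tendsto_nhds_unique (hL _) ?_
      refine (tendsto_finsetSum _ (fun i _ => hL (f i))).congr fun k => ?_
      rw [measure_biUnion_finset]
      · intro i _ j _ hij
        exact hd hij
      · intro i _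
        exact hf i
    have htail : Tendsto (fun n => ∑' i, L (f i) + c * μ (⋃ i, f i \ ⋃ i ∈ Finset.range n, f i)) atTop
        (𝓝 (∑' i, L (f i) + c * 0)) := by
      refine Tendsto.const_add _ (ENNReal.Tendsto.const_mul ?_ (Or.inr hc))
      have := tendsto_measure_iInter_atTop (μ := μ)
        (s := fun n => ⋃ j, f j \ ⋃ i ∈ Finset.range n, f i) ?_ ?_ ⟨0, measure_ne_top _ _⟩
      · have he : (⋂ n, ⋃ j, f j \ ⋃ i ∈ Finset.range n, f i) = (∅ : Set X) := ?_
        · rw [he, measure_empty] at this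
          exact this
        ext x
        simp only [mem_iInter, mem_iUnion, Set.mem_sdiff, mem_empty_iff_false, iff_false, not_forall]
        by_cases hx : ∃ j, x ∈ f j
        · obtain ⟨j, hj⟩ := hx
          refine ⟨j + 1, ?_⟩
          rintro ⟨k, hk, hk₂⟩
          exact hk₂ ⟨j, by simp, hj⟩
        · exact ⟨0, fun ⟨k, hk, _⟩ => hx ⟨k, hk⟩⟩
      · intro n
        refine (MeasurableSet.iUnion fun j => (hf j).diff ?_).nullMeasurableSet
        exact Finset.measurableSet_biUnion _ fun i _ => hf i
      · intro a b hab x hx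
        simp only [mem_iUnion, Set.mem_sdiff, Finset.mem_range, not_exists] at hx ⊢
        obtain ⟨j, hj, hx⟩ := hx
        exact ⟨j, hj, fun i hi => hx i (lt_of_lt_of_le hi hab)⟩
    refine le_antisymm ?_ ?_
    · rw [mul_zero, add_zero] at htail
      refine ge_of_tendsto htail (Eventually.of_forall fun n => ?_)
      have hmt : MeasurableSet (⋃ j, f j \ ⋃ i ∈ Finset.range n, f i) := 
        MeasurableSet.iUnion fun j => (hf j).diff (Finset.measurableSet_biUnion _ fun i _ => hf i)
      calc L (⋃ i, f i) ≤ L ((⋃ i ∈ Finset.range n, f i) ∪ ⋃ j, f j \ ⋃ i ∈ Finset.range n, f i) := by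
            apply hmono
            intro x hx
            obtain ⟨j, hj⟩ := mem_iUnion.1 hx
            by_cases hxx : x ∈ ⋃ i ∈ Finset.range n, f i
            · exact Or.inl hxx
            · exact Or.inr (mem_iUnion.2 ⟨j, hj, hxx⟩)
        _ = L (⋃ i ∈ Finset.range n, f i) + L (⋃ j, f j \ ⋃ i ∈ Finset.range n, f i) := by
            apply hadd _ _ hmt
            rw [Set.disjoint_iUnion_right]
            intro j
            exact disjoint_sdiff_right
        _ ≤ _ := by
            rw [hacc]
            exact add_le_add (ENNReal.sum_le_tsum _) (hle _ hmt)
    · rw [ENNReal.tsum_eq_iSup_nat]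
      refine iSup_le fun n => ?_
      rw [← hacc]
      exact hmono _ _ (iUnion₂_subset fun i _ => subset_iUnion f i)
  let l : Measure X := Measure.ofMeasurable (fun A _ => L A) h0 (fun f hf hd => hU hf hd)
  have hl : ∀ A, MeasurableSet A → l A = L A := fun A hA => Measure.ofMeasurable_apply A hA
  refine ⟨l, ⟨by rw [hl _ MeasurableSet.univ, h1]⟩, fun A hA => by rw [hl A hA]; exact hle A hA,
    fun A hA => by rw [hl A hA]; exact hL A⟩

theorem aux_lintegral_le {X : Type*} [MeasurableSpace X] (U : Ultrafilter ℕ)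
    (m : ℕ → Measure X) (l : Measure X)
    (hl : ∀ A, MeasurableSet A → Tendsto (fun n => m n A) U (𝓝 (l A)))
    (g : X → ℝ≥0∞) (hg1 : ∀ x, g x ≤ 1) (b : ℝ≥0∞)
    (hb : Tendsto (fun n => ∫⁻ x, g x ∂(m n)) U (𝓝 b)) : ∫⁻ x, g x ∂l ≤ b := by
  rw [lintegral_def]
  refine iSup₂_le fun φ hφ => ?_
  have h1 : Tendsto (fun n => φ.lintegral (m n)) U (𝓝 (φ.lintegral l)) := by
    unfold SimpleFunc.lintegral
    refine tendsto_finsetSum _ fun y hy => ?_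
    refine ENNReal.Tendsto.const_mul (hl _ (φ.measurableSet_fiber y)) (Or.inr ?_)
    obtain ⟨x, rfl⟩ := SimpleFunc.mem_range.1 hy
    exact ne_top_of_le_ne_top ENNReal.one_ne_top ((hφ x).trans (hg1 x))
  refine le_of_tendsto_of_tendsto h1 hb (Eventually.of_forall fun n => ?_)
  change φ.lintegral (m n) ≤ ∫⁻ x, g x ∂(m n)
  rw [← SimpleFunc.lintegral_eq_lintegral]
  exact lintegral_mono hφ

theorem aux_lintegral_tendsto {X : Type*} [MeasurableSpace X] (U : Ultrafilter ℕ)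
    (m : ℕ → Measure X) (hp : ∀ n, IsProbabilityMeasure (m n)) (l : Measure X)
    [IsProbabilityMeasure l]
    (hl : ∀ A, MeasurableSet A → Tendsto (fun n => m n A) U (𝓝 (l A)))
    (g : X → ℝ≥0∞) (hg : Measurable g) (hg1 : ∀ x, g x ≤ 1) :
    Tendsto (fun n => ∫⁻ x, g x ∂(m n)) U (𝓝 (∫⁻ x, g x ∂l)) := by
  obtain ⟨b, hb⟩ : ∃ a : ℝ≥0∞, Tendsto (fun n => ∫⁻ x, g x ∂(m n)) U (𝓝 a) :=
    ⟨_, (U.map (fun n => ∫⁻ x, g x ∂(m n))).le_nhds_lim⟩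
  have hsub : ∀ (ρ : Measure X), IsProbabilityMeasure ρ →
      ∫⁻ x, (1 - g x) ∂ρ = 1 - ∫⁻ x, g x ∂ρ := by
    intro ρ hρ
    rw [lintegral_sub hg _ (Eventually.of_forall hg1)]
    · simp
    · refine ne_top_of_le_ne_top ENNReal.one_ne_top ((lintegral_mono hg1).trans ?_)
      simp
  have h1 := aux_lintegral_le U m l hl g hg1 b hb
  have h2 := aux_lintegral_le U m l hl (fun x => 1 - g x) (fun x => tsub_le_self) (1 - b) (by
    simp_rw [fun n => hsub (m n) (hp n)]
    exact ENNReal.Tendsto.sub tendsto_const_nhds hb (Or.inl ENNReal.one_ne_top))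
  rw [hsub l inferInstance] at h2
  have hb1 : b ≤ 1 := le_of_tendsto hb (Eventually.of_forall fun n => by
    refine (lintegral_mono hg1).trans ?_
    simp)
  have h3 : b ≤ ∫⁻ x, g x ∂l := by
    have := (ENNReal.sub_le_sub_iff_left hb1 ENNReal.one_ne_top).1 h2
    exact this
  rwa [le_antisymm h1 h3]

/-- Extremality: an invariant probability measure dominated by an ergodic one equals it. -/
theorem MarkovFellerSemigroup.aux_ext {X : Type*} [MetricSpace X] [MeasurableSpace X]
    [BorelSpace X]
    (S : MarkovFellerSemigroup X) (μ l : Measure X) (hμ : S.ErgodicInv μ) (hl : S.Invariant l)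
    (c : ℝ≥0∞) (hc : c ≠ ⊤) (hle : l ≤ c • μ) : l = μ := by
  have := hμ.1.1
  have := hl.1
  -- `b` positive with `b ≤ 1` and `b * c ≤ 1`
  obtain ⟨b, hb0, hb1, hbc⟩ : ∃ b : ℝ≥0∞, b ≠ 0 ∧ b ≤ 1 ∧ b * c ≤ 1 := by
    refine ⟨(c + 1)⁻¹, by simp [hc], by simp, ?_⟩
    rw [mul_comm, ← div_eq_mul_inv]
    exact ENNReal.div_le_of_le_mul (by simp)
  have hbt : b ≠ ⊤ := ne_top_of_le_ne_top ENNReal.one_ne_top hb1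
  have hbl : b • l ≤ μ := by
    intro A
    calc (b • l) A = b * l A := by simp
      _ ≤ b * (c * μ A) := by gcongr; simpa using hle A
      _ = (b * c) * μ A := by ring
      _ ≤ 1 * μ A := by gcongr
      _ = μ A := one_mul _
  have : IsFiniteMeasure (b • l) := Measure.smul_finite _ hbt
  have hbt1 : (1 - b) ≠ ⊤ := ne_top_of_le_ne_top ENNReal.one_ne_top tsub_le_self
  have hinv : ∀ (t : ℝ), 0 ≤ t → ∀ A, MeasurableSet A → ∫⁻ x, S.P t x A ∂μ = μ A := by
    intro t ht A hA
    rw [← Measure.bind_apply hA (S.measurable_x t ht).aemeasurable]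
    exact congrArg (fun m : Measure X => m A) (hμ.1.2 t ht)
  have hinvl : ∀ (t : ℝ), 0 ≤ t → ∀ A, MeasurableSet A → ∫⁻ x, S.P t x A ∂l = l A := by
    intro t ht A hA
    rw [← Measure.bind_apply hA (S.measurable_x t ht).aemeasurable]
    exact congrArg (fun m : Measure X => m A) (hl.2 t ht)
  have hsub : (μ - b • l) + b • l = μ := Measure.sub_add_cancel_of_le hbl
  have hsubA : ∀ A, (μ - b • l) A + b * l A = μ A := fun A => by
    conv_rhs => rw [← hsub]
    simp
  have h1 : S.Invariant ((1 - b) • μ + b • l) := by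
    refine ⟨⟨?_⟩, fun t ht => ?_⟩
    · simp [tsub_add_cancel_of_le hb1]
    · ext A hA
      unfold MarkovFellerSemigroup.Pmeas
      rw [Measure.bind_apply hA (S.measurable_x t ht).aemeasurable]
      simp [lintegral_add_measure, lintegral_smul_measure, hinv t ht A hA, hinvl t ht A hA]
  have h2 : S.Invariant ((μ - b • l) + b • μ) := by
    refine ⟨⟨?_⟩, fun t ht => ?_⟩
    · have := hsubA univ
      simpa using this
    · ext A hA
      unfold MarkovFellerSemigroup.Pmeas
      rw [Measure.bind_apply hA (S.measurable_x t ht).aemeasurable]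
      have hk : ∫⁻ x, S.P t x A ∂(μ - b • l) + b * l A = μ A := by
        conv_rhs => rw [← hinv t ht A hA, ← hsub]
        simp [lintegral_add_measure, lintegral_smul_measure, hinvl t ht A hA]
      have hk2 : ∫⁻ x, S.P t x A ∂(μ - b • l) = (μ - b • l) A := by
        have h3 := hk.trans (hsubA A).symm
        exact (ENNReal.add_left_inj (ENNReal.mul_ne_top hbt (measure_ne_top _ _))).1 h3
      simp [lintegral_add_measure, lintegral_smul_measure, hinv t ht A hA, hk2]
  have h3 := (hμ.2 _ _ h1 h2 (by
    ext A hA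
    have h4 := hsubA A
    have h5 : (1 - b) * μ A + b * μ A = μ A := by
      rw [← add_mul, tsub_add_cancel_of_le hb1, one_mul]
    have h6 : (1 - b) * μ A + b * l A + ((μ - b • l) A + b * μ A) = 2 * μ A := by
      calc _ = ((1 - b) * μ A + b * μ A) + ((μ - b • l) A + b * l A) := by ring
        _ = _ := by rw [h4, h5]; ring
    simp only [Measure.smul_apply, Measure.add_apply, smul_eq_mul]
    rw [h6, ← mul_assoc, ENNReal.inv_mul_cancel (by simp) (by simp), one_mul])).1
  ext A hA
  have h4 : (1 - b) * μ A + b * l A = (1 - b) * μ A + b * μ A := by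
    rw [← add_mul, tsub_add_cancel_of_le hb1, one_mul]
    conv_rhs => rw [← h3]
    simp
  have h5 := (ENNReal.add_right_inj (ENNReal.mul_ne_top hbt1 (measure_ne_top _ _))).1 h4
  exact (ENNReal.mul_right_inj hb0 hbt).1 h5

namespace MarkovFellerSemigroup

/-- Uniform probability measure on `(0, T]`. -/
noncomputable def unifT (T : ℝ) : Measure ℝ :=
  (ENNReal.ofReal T)⁻¹ • (volume.restrict (Ioc 0 T))

theorem unifT_prob {T : ℝ} (hT : 0 < T) : IsProbabilityMeasure (unifT T) := by
  constructor
  simp only [unifT, Measure.smul_apply, Measure.restrict_apply MeasurableSet.univ, univ_inter,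
    Real.volume_Ioc, sub_zero, smul_eq_mul]
  exact ENNReal.inv_mul_cancel (by simpa using hT) ENNReal.ofReal_ne_top

section

variable {X : Type*} [MetricSpace X] [MeasurableSpace X] [BorelSpace X]

/-- Cesàro kernel. -/
noncomputable def Qk (S : MarkovFellerSemigroup X) (T : ℝ) (x : X) : Measure X :=
  (unifT T).bind (fun s => S.P (max s 0) x)

variable [TopologicalSpace.SeparableSpace X]

theorem measurable_joint (S : MarkovFellerSemigroup X) :
    Measurable (fun p : ℝ × X => S.P (max p.1 0) p.2) := by
  have : ∀ p : ℝ × X, IsProbabilityMeasure (S.P (max p.1 0) p.2) :=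
    fun p => S.isProb _ (le_max_right _ _) _
  have : SecondCountableTopology X := UniformSpace.secondCountable_of_separable X
  refine Measurable.measure_of_isPiSystem_of_isProbabilityMeasure
    (S := {s : Set X | IsClosed s}) ?_ isPiSystem_isClosed ?_
  · rw [BorelSpace.measurable_eq (α := X), borel_eq_generateFrom_isClosed]
  · intro F hF
    have hF : IsClosed F := hF
    have hpos : ∀ n : ℕ, (0:ℝ) < 1 / ((n:ℝ) + 1) := fun n => Nat.one_div_pos_of_nat
    refine measurable_of_tendsto_metrizable (f := fun (n : ℕ) (p : ℝ × X) =>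
      ∫⁻ y, (thickenedIndicator (hpos n) F y : ℝ≥0∞) ∂(S.P (max p.1 0) p.2)) ?_ ?_
    · intro n
      let f : BoundedContinuousFunction X ℝ :=
        BoundedContinuousFunction.ofNormedAddCommGroup
          (fun y => (thickenedIndicator (hpos n) F y : ℝ))
          (NNReal.continuous_coe.comp (thickenedIndicator (hpos n) F).continuous) 1 (by
            intro y
            simpa using thickenedIndicator_le_one (hpos n) F y)
      have heq : (fun p : ℝ × X =>
          ∫⁻ y, (thickenedIndicator (hpos n) F y : ℝ≥0∞) ∂(S.P (max p.1 0) p.2))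
          = fun p : ℝ × X => ENNReal.ofReal (∫ y, f y ∂(S.P (max p.1 0) p.2)) := by
        funext p
        rw [lintegral_coe_eq_integral]
        · rfl
        · exact integrable_thickenedIndicator F (hpos n)
      rw [heq]
      refine ENNReal.measurable_ofReal.comp ?_
      have h1 : Measurable (Function.uncurry
          (fun (x : X) (s : ℝ) => ∫ y, f y ∂(S.P (max s 0) x))) := by
        refine measurable_uncurry_of_continuous_of_measurable ?_ ?_
        · intro s
          exact S.feller f _ (le_max_right _ _)
        · intro x
          exact (S.measurable_t f x).comp (measurable_id.max measurable_const)
      exact h1.comp measurable_swap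
    · rw [tendsto_pi_nhds]
      intro p
      exact tendsto_lintegral_thickenedIndicator_of_isClosed _ hF hpos
        tendsto_one_div_add_atTop_nhds_zero_nat

theorem measurable_s (S : MarkovFellerSemigroup X) (x : X) :
    Measurable (fun s : ℝ => S.P (max s 0) x) :=
  S.measurable_joint.comp (measurable_id.prodMk measurable_const)

theorem Qk_lint (S : MarkovFellerSemigroup X) (T : ℝ) (x : X) (g : X → ℝ≥0∞)
    (hg : Measurable g) :
    ∫⁻ y, g y ∂(S.Qk T x) = ∫⁻ s, ∫⁻ y, g y ∂(S.P (max s 0) x) ∂(unifT T) :=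
  Measure.lintegral_bind (S.measurable_s x).aemeasurable hg.aemeasurable

theorem Qk_apply (S : MarkovFellerSemigroup X) (T : ℝ) (x : X) (A : Set X)
    (hA : MeasurableSet A) :
    S.Qk T x A = ∫⁻ s, S.P (max s 0) x A ∂(unifT T) :=
  Measure.bind_apply hA (S.measurable_s x).aemeasurable

theorem unifT_sfinite (T : ℝ) : SFinite (unifT T) := by
  unfold unifT; infer_instance

theorem Qk_measurable (S : MarkovFellerSemigroup X) (T : ℝ) : Measurable (S.Qk T) := by
  have := unifT_sfinite T
  refine Measure.measurable_of_measurable_coe _ fun A hA => ?_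
  simp_rw [S.Qk_apply T _ A hA]
  exact Measurable.lintegral_prod_left' (μ := unifT T)
    (f := fun p : ℝ × X => S.P (max p.1 0) p.2 A)
    ((Measure.measurable_coe hA).comp S.measurable_joint)

theorem Qk_prob (S : MarkovFellerSemigroup X) {T : ℝ} (hT : 0 < T) (x : X) :
    IsProbabilityMeasure (S.Qk T x) := by
  have := unifT_prob hT
  constructor
  rw [S.Qk_apply T x _ MeasurableSet.univ]
  have : ∀ s : ℝ, S.P (max s 0) x univ = 1 := fun s =>
    (S.isProb _ (le_max_right _ _) x).measure_univ
  simp [this]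

theorem Qk_inv (S : MarkovFellerSemigroup X) {T : ℝ} (hT : 0 < T) (μ : Measure X)
    (hμ : S.Invariant μ) : μ.bind (S.Qk T) = μ := by
  have := unifT_prob hT
  have := hμ.1
  ext A hA
  rw [Measure.bind_apply hA (S.Qk_measurable T).aemeasurable]
  simp_rw [S.Qk_apply T _ A hA]
  rw [lintegral_lintegral_swap]
  · have : ∀ s : ℝ, ∫⁻ x, S.P (max s 0) x A ∂μ = μ A := by
      intro s
      rw [← Measure.bind_apply hA (S.measurable_x _ (le_max_right _ _)).aemeasurable]
      exact congrArg (fun m : Measure X => m A) (hμ.2 _ (le_max_right _ _))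
    simp [this]
  · exact (((Measure.measurable_coe hA).comp S.measurable_joint).comp
      measurable_swap).aemeasurable

theorem Qk_shift (S : MarkovFellerSemigroup X) {T : ℝ} (t : ℝ) (ht : 0 ≤ t)
    (x : X) (A : Set X) (hA : MeasurableSet A) :
    ∫⁻ y, S.P t y A ∂(S.Qk T x) ≤ S.Qk T x A + (ENNReal.ofReal T)⁻¹ * ENNReal.ofReal t := by
  rw [S.Qk_lint T x (fun y => S.P t y A) ((Measure.measurable_coe hA).comp (S.measurable_x t ht)),
    S.Qk_apply T x A hA]
  unfold unifT
  rw [lintegral_smul_measure, lintegral_smul_measure, smul_eq_mul, smul_eq_mul, ← mul_add]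
  gcongr
  let g : ℝ → ℝ≥0∞ := fun s => S.P (max s 0) x A
  have hg : Measurable g := (Measure.measurable_coe hA).comp (S.measurable_s x)
  have hg1 : ∀ s, g s ≤ 1 := fun s => by
    have := S.isProb (max s 0) (le_max_right _ _) x
    exact prob_le_one
  calc ∫⁻ s in Ioc 0 T, ∫⁻ y, S.P t y A ∂(S.P (max s 0) x)
      = ∫⁻ s in Ioc 0 T, g (s + t) := by
        refine setLIntegral_congr_fun measurableSet_Ioc fun s hs => ?_
        change ∫⁻ y, S.P t y A ∂(S.P (max s 0) x) = S.P (max (s + t) 0) x A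
        rw [max_eq_left hs.1.le, max_eq_left (by linarith [hs.1]), S.semigroup t s ht hs.1.le x,
          Measure.bind_apply hA (S.measurable_x t ht).aemeasurable]
    _ = ∫⁻ s in Ioc t (T + t), g s := by
        have h1 := (measurePreserving_add_right (volume : Measure ℝ) t).setLIntegral_comp_preimage
          (s := Ioc t (T + t)) measurableSet_Ioc hg
        rw [← h1]
        simp
    _ ≤ ∫⁻ s in Ioc 0 T ∪ Ioc T (T + t), g s := by
        refine lintegral_mono_set fun s hs => ?_
        by_cases h : s ≤ T
        · exact Or.inl ⟨lt_of_le_of_lt ht hs.1, h⟩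
        · exact Or.inr ⟨not_le.1 h, hs.2⟩
    _ ≤ (∫⁻ s in Ioc 0 T, g s) + ∫⁻ s in Ioc T (T + t), g s := lintegral_union_le _ _ _
    _ ≤ (∫⁻ s in Ioc 0 T, g s) + ENNReal.ofReal t := by
        gcongr
        refine (lintegral_mono hg1).trans ?_
        simp

/-- Key lemma. -/
theorem key_tendsto (S : MarkovFellerSemigroup X) (U : Ultrafilter ℕ) (hU : (U : Filter ℕ) ≤ atTop)
    (μ : Measure X) (hμ : S.ErgodicInv μ) (m : Measure X) [IsProbabilityMeasure m]
    (c : ℝ≥0∞) (hc : c ≠ ⊤) (hm : m ≤ c • μ) (g : X → ℝ≥0∞) (hg : Measurable g)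
    (hg1 : ∀ x, g x ≤ 1) :
    Tendsto (fun n : ℕ => ∫⁻ x, ∫⁻ y, g y ∂(S.Qk ((n:ℝ) + 1) x) ∂m) U (𝓝 (∫⁻ x, g x ∂μ)) := by
  have := hμ.1.1
  have hT : ∀ n : ℕ, (0:ℝ) < (n:ℝ) + 1 := fun n => by positivity
  let M : ℕ → Measure X := fun n => m.bind (S.Qk ((n:ℝ) + 1))
  have hMl : ∀ n (g : X → ℝ≥0∞), Measurable g →
      ∫⁻ y, g y ∂(M n) = ∫⁻ x, ∫⁻ y, g y ∂(S.Qk ((n:ℝ) + 1) x) ∂m := fun n g hg =>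
    Measure.lintegral_bind (S.Qk_measurable _).aemeasurable hg.aemeasurable
  have hMa : ∀ n A, MeasurableSet A → M n A = ∫⁻ x, S.Qk ((n:ℝ) + 1) x A ∂m := fun n A hA =>
    Measure.bind_apply hA (S.Qk_measurable _).aemeasurable
  have hMp : ∀ n, IsProbabilityMeasure (M n) := by
    intro n
    constructor
    rw [hMa n _ MeasurableSet.univ]
    have : ∀ x, S.Qk ((n:ℝ) + 1) x univ = 1 := fun x => (S.Qk_prob (hT n) x).measure_univ
    simp [this]
  have hMc : ∀ n A, MeasurableSet A → M n A ≤ c * μ A := by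
    intro n A hA
    rw [hMa n A hA]
    refine (lintegral_mono' hm le_rfl).trans ?_
    rw [lintegral_smul_measure, ← Measure.bind_apply hA (S.Qk_measurable _).aemeasurable,
      S.Qk_inv (hT n) μ hμ.1, smul_eq_mul]
  obtain ⟨l, hlp, hlc, hl⟩ := aux_exists_limit U M hMp μ c hc hMc
  have hinv : S.Invariant l := by
    refine ⟨hlp, fun t ht => ?_⟩
    have hpr : IsProbabilityMeasure (S.Pmeas t l) := by
      constructor
      unfold MarkovFellerSemigroup.Pmeas
      rw [Measure.bind_apply MeasurableSet.univ (S.measurable_x t ht).aemeasurable]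
      have : ∀ x, S.P t x univ = 1 := fun x => (S.isProb t ht x).measure_univ
      simp [this]
    refine Measure.eq_of_le_of_isProbabilityMeasure ?_
    refine Measure.le_iff.2 fun A hA => ?_
    unfold MarkovFellerSemigroup.Pmeas
    rw [Measure.bind_apply hA (S.measurable_x t ht).aemeasurable]
    have hPm : Measurable fun y => S.P t y A :=
      (Measure.measurable_coe hA).comp (S.measurable_x t ht)
    have hP1 : ∀ y, S.P t y A ≤ 1 := fun y => by
      have := S.isProb t ht y
      exact prob_le_one
    have h1 := aux_lintegral_tendsto U M hMp l hl (fun y => S.P t y A) hPm hP1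
    have h2 : Tendsto (fun n : ℕ => M n A + (ENNReal.ofReal ((n:ℝ) + 1))⁻¹ * ENNReal.ofReal t) U
        (𝓝 (l A + 0 * ENNReal.ofReal t)) := by
      refine (hl A hA).add (ENNReal.Tendsto.mul_const ?_ (Or.inr ENNReal.ofReal_ne_top))
      refine Tendsto.mono_left ?_ hU
      rw [← ENNReal.inv_top]
      refine tendsto_inv_iff.2 ?_
      exact ENNReal.tendsto_ofReal_atTop.comp
        (tendsto_atTop_add_const_right _ _ tendsto_natCast_atTop_atTop)
    rw [zero_mul, add_zero] at h2
    refine le_of_tendsto_of_tendsto h1 h2 (Eventually.of_forall fun n => ?_)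
    change ∫⁻ y, S.P t y A ∂(M n) ≤ M n A + (ENNReal.ofReal ((n:ℝ) + 1))⁻¹ * ENNReal.ofReal t
    rw [hMl n _ hPm, hMa n A hA]
    refine (lintegral_mono fun x => S.Qk_shift t ht x A hA).trans ?_
    rw [lintegral_add_right _ measurable_const]
    simp
  have hlμ : l = μ := S.aux_ext μ l hμ hinv c hc (Measure.le_iff.2 fun A hA => by
    simpa using hlc A hA)
  have h3 := aux_lintegral_tendsto U M hMp l hl g hg hg1
  rw [hlμ] at h3
  exact h3.congr fun n => hMl n g hg

end

end MarkovFellerSemigroup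

namespace MarkovFellerSemigroup

section

variable {X : Type*} [MetricSpace X] [MeasurableSpace X] [BorelSpace X]
variable [TopologicalSpace.SeparableSpace X]

theorem Qf_eq (S : MarkovFellerSemigroup X) {T : ℝ} (hT : 0 < T) (f : X → NNReal)
    (hf : Measurable f) (hf1 : ∀ x, f x ≤ 1) (x : X) :
    S.Qf T (fun y => (f y : ℝ)) x = (∫⁻ y, (f y : ℝ≥0∞) ∂(S.Qk T x)).toReal := by
  have hfm : Measurable fun y => (f y : ℝ≥0∞) := measurable_coe_nnreal_ennreal.comp hf
  have hlt : ∀ s : ℝ, ∫⁻ y, (f y : ℝ≥0∞) ∂(S.P (max s 0) x) < ⊤ := fun s => by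
    have := S.isProb (max s 0) (le_max_right _ _) x
    refine lt_of_le_of_lt (lintegral_mono (g := fun _ => 1) fun y => ?_) (by simp)
    exact ENNReal.coe_le_one_iff.2 (hf1 y)
  have hgm : Measurable fun s : ℝ => ∫⁻ y, (f y : ℝ≥0∞) ∂(S.P (max s 0) x) :=
    (Measure.measurable_lintegral hfm).comp (S.measurable_s x)
  rw [S.Qk_lint T x _ hfm]
  unfold unifT
  rw [lintegral_smul_measure, smul_eq_mul, ENNReal.toReal_mul, ENNReal.toReal_inv,
    ENNReal.toReal_ofReal hT.le]
  unfold Qf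
  rw [one_div, intervalIntegral.integral_of_le hT.le, ← integral_toReal hgm.aemeasurable
    (Eventually.of_forall hlt)]
  congr 1
  refine setIntegral_congr_fun measurableSet_Ioc fun s hs => ?_
  change ∫ y, (f y : ℝ) ∂(S.P s x) = (∫⁻ y, (f y : ℝ≥0∞) ∂(S.P (max s 0) x)).toReal
  rw [max_eq_left hs.1.le, ← integral_toReal hfm.aemeasurable
    (Eventually.of_forall fun y => ENNReal.coe_lt_top)]
  rfl

theorem Qk_lint_le (S : MarkovFellerSemigroup X) {T : ℝ} (hT : 0 < T) (f : X → NNReal)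
    (hf1 : ∀ x, f x ≤ 1) (x : X) : ∫⁻ y, (f y : ℝ≥0∞) ∂(S.Qk T x) ≤ 1 := by
  have := S.Qk_prob hT x
  refine (lintegral_mono (g := fun _ => 1) fun y => ?_).trans (by simp)
  exact ENNReal.coe_le_one_iff.2 (hf1 y)

theorem Qf_bound (S : MarkovFellerSemigroup X) {T : ℝ} (hT : 0 < T) (f : X → NNReal)
    (hf : Measurable f) (hf1 : ∀ x, f x ≤ 1) (x z : X) :
    |S.Qf T (fun y => (f y : ℝ)) x - S.Qf T (fun y => (f y : ℝ)) z| ≤ 1 := by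
  rw [S.Qf_eq hT f hf hf1, S.Qf_eq hT f hf hf1]
  have h := fun x => ENNReal.toReal_mono ENNReal.one_ne_top (S.Qk_lint_le hT f hf1 x)
  have h1 := h x
  have h2 := h z
  rw [ENNReal.toReal_one] at h1 h2
  have h3 := ENNReal.toReal_nonneg (a := ∫⁻ y, (f y : ℝ≥0∞) ∂(S.Qk T x))
  have h4 := ENNReal.toReal_nonneg (a := ∫⁻ y, (f y : ℝ≥0∞) ∂(S.Qk T z))
  rw [abs_le]
  constructor <;> linarith

theorem near (S : MarkovFellerSemigroup X) (z : X) (h : S.CesaroEvContAt z) (f : X → NNReal)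
    (K : NNReal) (hf : LipschitzWith K f) (hf1 : ∀ x, f x ≤ 1) (ε : ℝ) (hε : 0 < ε) :
    ∃ δ > 0, ∀ x ∈ ball z δ, ∃ N : ℕ, ∀ n ≥ N,
      ∫⁻ y, (f y : ℝ≥0∞) ∂(S.Qk ((n:ℝ) + 1) x) ≤
        ∫⁻ y, (f y : ℝ≥0∞) ∂(S.Qk ((n:ℝ) + 1) z) + ENNReal.ofReal ε ∧
      ∫⁻ y, (f y : ℝ≥0∞) ∂(S.Qk ((n:ℝ) + 1) z) ≤
        ∫⁻ y, (f y : ℝ≥0∞) ∂(S.Qk ((n:ℝ) + 1) x) + ENNReal.ofReal ε := by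
  have hfm : Measurable f := hf.continuous.measurable
  have hbl : IsBddLipschitz (fun y => (f y : ℝ)) := by
    refine ⟨⟨K, fun x y => hf x y⟩, 1, fun x => ?_⟩
    simpa using hf1 x
  have h0 := h _ hbl
  let G : X → ℝ → ℝ := fun x t => |S.Qf t (fun y => (f y : ℝ)) x - S.Qf t (fun y => (f y : ℝ)) z|
  have hG1 : ∀ x, ∀ᶠ t in atTop, G x t ≤ 1 := fun x => by
    filter_upwards [eventually_gt_atTop (0:ℝ)] with t ht
    exact S.Qf_bound ht f hfm hf1 x z
  have hGb : ∀ x, IsBoundedUnder (· ≤ ·) atTop (G x) := fun x => ⟨1, hG1 x⟩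
  have hGc : ∀ x, IsCoboundedUnder (· ≤ ·) atTop (G x) := fun x =>
    IsBoundedUnder.isCoboundedUnder_le
      (isBoundedUnder_of ⟨0, fun t => abs_nonneg _⟩)
  have hI : IsBoundedUnder (· ≤ ·) (𝓝 z) (fun x => limsup (G x) atTop) :=
    isBoundedUnder_of ⟨1, fun x => limsup_le_of_le (hGc x) (hG1 x)⟩
  have h1 : ∀ᶠ x in 𝓝 z, limsup (G x) atTop < ε :=
    eventually_lt_of_limsup_lt (lt_of_eq_of_lt h0 hε) hI
  obtain ⟨δ, hδ, hball⟩ := Metric.eventually_nhds_iff_ball.1 h1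
  refine ⟨δ, hδ, fun x hx => ?_⟩
  have h2 : ∀ᶠ t in atTop, G x t < ε := eventually_lt_of_limsup_lt (hball x hx) (hGb x)
  have h3 : ∀ᶠ n : ℕ in atTop, G x ((n:ℝ) + 1) < ε :=
    (tendsto_atTop_add_const_right _ _ tendsto_natCast_atTop_atTop).eventually h2
  obtain ⟨N, hN⟩ := eventually_atTop.1 h3
  refine ⟨N, fun n hn => ?_⟩
  have hT : (0:ℝ) < (n:ℝ) + 1 := by positivity
  have h4 := hN n hn
  simp only [G] at h4
  rw [S.Qf_eq hT f hfm hf1, S.Qf_eq hT f hfm hf1, abs_lt] at h4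
  have ha := ne_top_of_le_ne_top ENNReal.one_ne_top (S.Qk_lint_le hT f hf1 x)
  have hb := ne_top_of_le_ne_top ENNReal.one_ne_top (S.Qk_lint_le hT f hf1 z)
  constructor
  · rw [← ENNReal.toReal_le_toReal ha (ENNReal.add_ne_top.2 ⟨hb, ENNReal.ofReal_ne_top⟩),
      ENNReal.toReal_add hb ENNReal.ofReal_ne_top, ENNReal.toReal_ofReal hε.le]
    linarith
  · rw [← ENNReal.toReal_le_toReal hb (ENNReal.add_ne_top.2 ⟨ha, ENNReal.ofReal_ne_top⟩),
      ENNReal.toReal_add ha ENNReal.ofReal_ne_top, ENNReal.toReal_ofReal hε.le]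
    linarith

theorem exists_m (S : MarkovFellerSemigroup X) (μ : Measure X) [IsProbabilityMeasure μ] (z : X)
    (h : S.CesaroEvContAt z) (hz : z ∈ msupp μ) (f : X → NNReal)
    (K : NNReal) (hf : LipschitzWith K f) (hf1 : ∀ x, f x ≤ 1) (ε : ℝ) (hε : 0 < ε) :
    ∃ m : Measure X, IsProbabilityMeasure m ∧ (∃ c : ℝ≥0∞, c ≠ ⊤ ∧ m ≤ c • μ) ∧
      ∃ N : ℕ, ∀ n ≥ N,
      ∫⁻ x, ∫⁻ y, (f y : ℝ≥0∞) ∂(S.Qk ((n:ℝ) + 1) x) ∂m ≤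
        ∫⁻ y, (f y : ℝ≥0∞) ∂(S.Qk ((n:ℝ) + 1) z) + ENNReal.ofReal ε ∧
      ∫⁻ y, (f y : ℝ≥0∞) ∂(S.Qk ((n:ℝ) + 1) z) ≤
        ∫⁻ x, ∫⁻ y, (f y : ℝ≥0∞) ∂(S.Qk ((n:ℝ) + 1) x) ∂m + ENNReal.ofReal ε := by
  obtain ⟨δ, hδ, hball⟩ := S.near z h f K hf hf1 ε hε
  have hfm : Measurable fun y => (f y : ℝ≥0∞) :=
    measurable_coe_nnreal_ennreal.comp hf.continuous.measurable
  let F : ℕ → X → ℝ≥0∞ := fun n x => ∫⁻ y, (f y : ℝ≥0∞) ∂(S.Qk ((n:ℝ) + 1) x)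
  have hFm : ∀ n, Measurable (F n) := fun n =>
    (Measure.measurable_lintegral hfm).comp (S.Qk_measurable _)
  let A : ℕ → Set X := fun N => ⋂ n ∈ Ici N,
    ({x | F n x ≤ F n z + ENNReal.ofReal ε} ∩ {x | F n z ≤ F n x + ENNReal.ofReal ε})
  have hAm : ∀ N, MeasurableSet (A N) := fun N =>
    MeasurableSet.biInter (to_countable _) fun n _ =>
      (measurableSet_le (hFm n) measurable_const).inter
        (measurableSet_le measurable_const ((hFm n).add_const _))
  have hsub : ball z δ ⊆ ⋃ N, A N := by
    intro x hx
    obtain ⟨N, hN⟩ := hball x hx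
    exact mem_iUnion.2 ⟨N, mem_iInter₂.2 fun n hn => hN n hn⟩
  obtain ⟨N, hN⟩ : ∃ N, μ (A N) ≠ 0 := by
    by_contra hcon
    push Not at hcon
    have := measure_mono_null hsub (measure_iUnion_null hcon)
    exact (hz δ hδ).ne' this
  refine ⟨(μ (A N))⁻¹ • μ.restrict (A N), ?_, ⟨(μ (A N))⁻¹, by simpa using hN, ?_⟩, N, ?_⟩
  · constructor
    simp only [Measure.smul_apply, Measure.restrict_apply MeasurableSet.univ, univ_inter,
      smul_eq_mul]
    exact ENNReal.inv_mul_cancel hN (measure_ne_top _ _)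
  · refine Measure.le_iff.2 fun B hB => ?_
    simp only [Measure.smul_apply, smul_eq_mul]
    gcongr
    exact Measure.restrict_le_self
  · intro n hn
    have hcan : (μ (A N))⁻¹ * μ (A N) = 1 := ENNReal.inv_mul_cancel hN (measure_ne_top _ _)
    have hmem : ∀ x ∈ A N, F n x ≤ F n z + ENNReal.ofReal ε ∧ F n z ≤ F n x + ENNReal.ofReal ε :=
      fun x hx => mem_iInter₂.1 hx n hn
    rw [lintegral_smul_measure, smul_eq_mul]
    change (μ (A N))⁻¹ * ∫⁻ x in A N, F n x ∂μ ≤ F n z + _ ∧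
      F n z ≤ (μ (A N))⁻¹ * ∫⁻ x in A N, F n x ∂μ + _
    constructor
    · calc (μ (A N))⁻¹ * ∫⁻ x in A N, F n x ∂μ
          ≤ (μ (A N))⁻¹ * ∫⁻ x in A N, (F n z + ENNReal.ofReal ε) ∂μ := by
            gcongr 1
            exact setLIntegral_mono' (hAm N) fun x hx => (hmem x hx).1
        _ = ((μ (A N))⁻¹ * μ (A N)) * (F n z + ENNReal.ofReal ε) := by
            rw [setLIntegral_const]; ring
        _ = _ := by rw [hcan, one_mul]
    · calc F n z = (μ (A N))⁻¹ * ∫⁻ x in A N, F n z ∂μ := by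
            rw [setLIntegral_const, mul_comm (F n z), ← mul_assoc, hcan, one_mul]
        _ ≤ (μ (A N))⁻¹ * ∫⁻ x in A N, (F n x + ENNReal.ofReal ε) ∂μ := by
            gcongr 1
            exact setLIntegral_mono' (hAm N) fun x hx => (hmem x hx).2
        _ = (μ (A N))⁻¹ * ∫⁻ x in A N, F n x ∂μ
            + ((μ (A N))⁻¹ * μ (A N)) * ENNReal.ofReal ε := by
            rw [lintegral_add_right _ measurable_const, setLIntegral_const]; ring
        _ = _ := by rw [hcan, one_mul]

theorem lint_le (S : MarkovFellerSemigroup X) (μ ν : Measure X) (hμ : S.ErgodicInv μ)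
    (hν : S.ErgodicInv ν) (z : X) (h : S.CesaroEvContAt z) (hz : z ∈ msupp μ) (hz₂ : z ∈ msupp ν)
    (f : X → NNReal) (K : NNReal) (hf : LipschitzWith K f) (hf1 : ∀ x, f x ≤ 1) :
    ∫⁻ y, (f y : ℝ≥0∞) ∂μ ≤ ∫⁻ y, (f y : ℝ≥0∞) ∂ν := by
  have := hμ.1.1
  have := hν.1.1
  have hfm : Measurable fun y => (f y : ℝ≥0∞) :=
    measurable_coe_nnreal_ennreal.comp hf.continuous.measurable
  have hfe : ∀ x, (f x : ℝ≥0∞) ≤ 1 := fun x => by exact_mod_cast hf1 x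
  refine ENNReal.le_of_forall_pos_le_add fun e he _ => ?_
  have hε : (0:ℝ) < (e:ℝ) / 2 := by positivity
  obtain ⟨m, hm, ⟨c, hc, hmc⟩, N, hN⟩ := S.exists_m μ z h hz f K hf hf1 _ hε
  obtain ⟨m₂, hm₂, ⟨c₂, hc₂, hmc₂⟩, N₂, hN₂⟩ := S.exists_m ν z h hz₂ f K hf hf1 _ hε
  let U : Ultrafilter ℕ := Ultrafilter.of atTop
  have hU : (U : Filter ℕ) ≤ atTop := Ultrafilter.of_le _
  have t1 := S.key_tendsto U hU μ hμ m c hc hmc _ hfm hfe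
  have t2 := (S.key_tendsto U hU ν hν m₂ c₂ hc₂ hmc₂ _ hfm hfe).add_const (e : ℝ≥0∞)
  refine le_of_tendsto_of_tendsto t1 t2 (hU ?_)
  filter_upwards [eventually_ge_atTop N, eventually_ge_atTop N₂] with n hn hn₂
  refine (hN n hn).1.trans ?_
  refine (add_le_add_left (hN₂ n hn₂).2 _).trans ?_
  rw [add_assoc, ← ENNReal.ofReal_add hε.le hε.le, add_halves, ENNReal.ofReal_coe_nnreal]

end

end MarkovFellerSemigroup

namespace MarkovFellerSemigroup

variable {X : Type*} [MetricSpace X] [CompleteSpace X]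
  [TopologicalSpace.SeparableSpace X] [MeasurableSpace X] [BorelSpace X]

theorem ergodic_measures_disjoint_supports (S : MarkovFellerSemigroup X)
    (h : ∀ z : X, S.CesaroEvContAt z) (μ ν : Measure X)
    (hμ : S.ErgodicInv μ) (hν : S.ErgodicInv ν) (hne : μ ≠ ν) :
    msupp μ ∩ msupp ν = ∅ := by
  rw [Set.eq_empty_iff_forall_notMem]
  rintro z ⟨hz, hz₂⟩
  apply hne
  have := hμ.1.1
  have := hν.1.1
  have hpos : ∀ n : ℕ, (0:ℝ) < 1 / ((n:ℝ) + 1) := fun n => Nat.one_div_pos_of_nat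
  refine ext_of_generate_finite {s : Set X | IsClosed s} ?_ isPiSystem_isClosed
    (fun F hF => ?_) (by simp)
  · rw [BorelSpace.measurable_eq (α := X), borel_eq_generateFrom_isClosed]
  · have t1 := tendsto_lintegral_thickenedIndicator_of_isClosed μ (F := F) hF hpos
      tendsto_one_div_add_atTop_nhds_zero_nat
    have t2 := tendsto_lintegral_thickenedIndicator_of_isClosed ν (F := F) hF hpos
      tendsto_one_div_add_atTop_nhds_zero_nat
    refine tendsto_nhds_unique t1 (t2.congr fun n => ?_)
    have hl := lipschitzWith_thickenedIndicator (hpos n) F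
    have h1 := fun x => thickenedIndicator_le_one (hpos n) F x
    exact le_antisymm (S.lint_le ν μ hν hμ z (h z) hz₂ hz _ _ hl h1)
      (S.lint_le μ ν hμ hν z (h z) hz hz₂ _ _ hl h1)

end MarkovFellerSemigroup
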